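/- Let I = (−ρ, ρ) where 0 < ρ ≤ ∞, and let k be a positive integer. For a function f : I → ℝ, the following are equivalent: (1) for every n ≥ k and every A ∈ S_n^{(k)}(I), the entrywise transform f[A] lies in S_n^{(k)}; (2) either f(x) = c·x for all x ∈ I for some constant c > 0, or k = 1 and f(x) = −c for all x ∈ I for some constant c > 0. -/

import Mathlib

/-- The number of negative eigenvalues (with multiplicity) of a real symmetric
(Hermitian) matrix; junk value `0` if the matrix is not Hermitian. -/
noncomputable def negEigCount {n : Type*} [Fintype n] [DecidableEq n]
    (A : Matrix n n ℝ) : ℕ :=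
  if hA : A.IsHermitian then Nat.card {i // hA.eigenvalues i < 0} else 0

/-- Membership in the interval `(-ρ, ρ)` for `ρ : EReal` (so `ρ = ∞` is allowed). -/
def memI (ρ : EReal) (x : ℝ) : Prop := -ρ < (x : EReal) ∧ (x : EReal) < ρ

open Matrix Module

theorem dotProduct_mulVec_eq_sum_eigenvalues {n : Type*} [Fintype n] [DecidableEq n]
    {A : Matrix n n ℝ} (hA : A.IsHermitian) (x : n → ℝ) :
    x ⬝ᵥ A *ᵥ x = ∑ i, hA.eigenvalues i *
      (star (hA.eigenvectorUnitary : Matrix n n ℝ) *ᵥ x) i ^ 2 := by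
  conv_lhs => rw [hA.spectral_theorem]
  rw [Unitary.conjStarAlgAut_apply]
  rw [← Matrix.mulVec_mulVec, ← Matrix.mulVec_mulVec, Matrix.dotProduct_mulVec,
    Matrix.star_eq_conjTranspose, Matrix.conjTranspose_eq_transpose_of_trivial,
    ← Matrix.mulVec_transpose]
  simp only [dotProduct, mulVec_diagonal, Function.comp_apply]
  refine Finset.sum_congr rfl fun i _ => ?_
  simp
  ring

theorem exists_nonneg_on_ker {n : Type*} [Fintype n] [DecidableEq n] {A : Matrix n n ℝ}
    (hA : A.IsHermitian) :
    ∃ φ : (n → ℝ) →ₗ[ℝ] (Fin (negEigCount A) → ℝ), ∀ x, φ x = 0 → 0 ≤ x ⬝ᵥ A *ᵥ x := by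
  have hc : Fintype.card {i // hA.eigenvalues i < 0} = negEigCount A := by
    rw [negEigCount, dif_pos hA, Nat.card_eq_fintype_card]
  let e := Fintype.equivFinOfCardEq hc
  refine ⟨(LinearMap.funLeft ℝ ℝ fun j => (e.symm j : n)) ∘ₗ
    (star (hA.eigenvectorUnitary : Matrix n n ℝ)).mulVecLin, fun x hx => ?_⟩
  rw [dotProduct_mulVec_eq_sum_eigenvalues hA]
  refine Finset.sum_nonneg fun i _ => ?_
  by_cases hi : hA.eigenvalues i < 0
  · have := congrFun hx (e ⟨i, hi⟩)
    simp [LinearMap.funLeft_apply] at this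
    simp [this]
  · exact mul_nonneg (not_lt.mp hi) (sq_nonneg _)

theorem exists_neg_on_range {n : Type*} [Fintype n] [DecidableEq n] {A : Matrix n n ℝ}
    (hA : A.IsHermitian) :
    ∃ ψ : (Fin (negEigCount A) → ℝ) →ₗ[ℝ] (n → ℝ), ∀ w, w ≠ 0 → ψ w ⬝ᵥ A *ᵥ ψ w < 0 := by
  have hc : Fintype.card {i // hA.eigenvalues i < 0} = negEigCount A := by
    rw [negEigCount, dif_pos hA, Nat.card_eq_fintype_card]
  let e := Fintype.equivFinOfCardEq hc
  have hinj : Function.Injective fun j => (e.symm j : n) :=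
    Subtype.val_injective.comp e.symm.injective
  refine ⟨(hA.eigenvectorUnitary : Matrix n n ℝ).mulVecLin ∘ₗ
    Function.ExtendByZero.linearMap ℝ (fun j => (e.symm j : n)), fun w hw => ?_⟩
  rw [dotProduct_mulVec_eq_sum_eigenvalues hA]
  have hU : star (hA.eigenvectorUnitary : Matrix n n ℝ) * (hA.eigenvectorUnitary : Matrix n n ℝ)
      = 1 := Unitary.coe_star_mul_self _
  simp only [LinearMap.comp_apply, Matrix.mulVecLin_apply, Matrix.mulVec_mulVec, hU,
    Matrix.one_mulVec, Function.ExtendByZero.linearMap_apply]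
  obtain ⟨j, hj⟩ := Function.ne_iff.mp hw
  refine Finset.sum_neg' (fun i _ => ?_) ⟨(e.symm j : n), Finset.mem_univ _, ?_⟩
  · by_cases hi : hA.eigenvalues i < 0
    · exact mul_nonpos_of_nonpos_of_nonneg hi.le (sq_nonneg _)
    · rw [Function.extend_apply']
      · simp
      · rintro ⟨j, rfl⟩
        exact hi (e.symm j).2
  · rw [hinj.extend_apply]
    exact mul_neg_of_neg_of_pos (e.symm j).2 (sq_pos_iff.mpr hj)

theorem finrank_le_of_neg_of_nonneg {n E F : Type*} [Fintype n] {A : Matrix n n ℝ}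
    [AddCommGroup E] [Module ℝ E] [FiniteDimensional ℝ E]
    [AddCommGroup F] [Module ℝ F] [FiniteDimensional ℝ F]
    (ψ : E →ₗ[ℝ] (n → ℝ)) (hψ : ∀ w, w ≠ 0 → ψ w ⬝ᵥ A *ᵥ ψ w < 0)
    (φ : (n → ℝ) →ₗ[ℝ] F) (hφ : ∀ x, φ x = 0 → 0 ≤ x ⬝ᵥ A *ᵥ x) :
    finrank ℝ E ≤ finrank ℝ F := by
  by_contra! h
  obtain ⟨w, hw, hw0⟩ := Submodule.exists_mem_ne_zero_of_ne_bot
    (LinearMap.ker_ne_bot_of_finrank_lt (f := φ ∘ₗ ψ) h)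
  exact (hψ w hw0).not_ge (hφ _ hw)

theorem finrank_le_negEigCount {n E : Type*} [Fintype n] [DecidableEq n] {A : Matrix n n ℝ}
    (hA : A.IsHermitian) [AddCommGroup E] [Module ℝ E] [FiniteDimensional ℝ E]
    (ψ : E →ₗ[ℝ] (n → ℝ)) (hψ : ∀ w, w ≠ 0 → ψ w ⬝ᵥ A *ᵥ ψ w < 0) :
    finrank ℝ E ≤ negEigCount A := by
  obtain ⟨φ, hφ⟩ := exists_nonneg_on_ker hA
  simpa using finrank_le_of_neg_of_nonneg ψ hψ φ hφ

theorem negEigCount_le_finrank {n F : Type*} [Fintype n] [DecidableEq n] {A : Matrix n n ℝ}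
    (hA : A.IsHermitian) [AddCommGroup F] [Module ℝ F] [FiniteDimensional ℝ F]
    (φ : (n → ℝ) →ₗ[ℝ] F) (hφ : ∀ x, φ x = 0 → 0 ≤ x ⬝ᵥ A *ᵥ x) :
    negEigCount A ≤ finrank ℝ F := by
  obtain ⟨ψ, hψ⟩ := exists_neg_on_range hA
  simpa using finrank_le_of_neg_of_nonneg ψ hψ φ hφ

theorem negEigCount_le_card {n : Type*} [Fintype n] [DecidableEq n] {A : Matrix n n ℝ}
    (hA : A.IsHermitian) : negEigCount A ≤ Fintype.card n := by
  simpa using negEigCount_le_finrank hA LinearMap.id (by rintro x rfl; simp)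

theorem negEigCount_eq_card_iff {n : Type*} [Fintype n] [DecidableEq n] {A : Matrix n n ℝ}
    (hA : A.IsHermitian) :
    negEigCount A = Fintype.card n ↔ ∀ x, x ≠ 0 → x ⬝ᵥ A *ᵥ x < 0 := by
  refine ⟨fun h x hx => ?_, fun h => (negEigCount_le_card hA).antisymm ?_⟩
  · by_contra! hneg
    have h1 := negEigCount_le_finrank hA (Submodule.mkQ (ℝ ∙ x)) fun y hy => by
      rw [Submodule.mkQ_apply, Submodule.Quotient.mk_eq_zero,
        Submodule.mem_span_singleton] at hy
      obtain ⟨a, rfl⟩ := hy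
      rw [Matrix.mulVec_smul, dotProduct_smul, smul_dotProduct, smul_smul, smul_eq_mul]
      exact mul_nonneg (mul_self_nonneg a) hneg
    have h2 := Submodule.finrank_quotient_add_finrank (ℝ ∙ x)
    rw [finrank_span_singleton hx, finrank_fintype_fun_eq_card] at h2
    omega
  · simpa using finrank_le_negEigCount hA LinearMap.id h

theorem negEigCount_smul {n : Type*} [Fintype n] [DecidableEq n] {A : Matrix n n ℝ}
    (hA : A.IsHermitian) {c : ℝ} (hc : 0 < c) : negEigCount (c • A) = negEigCount A := by
  have hcA : (c • A).IsHermitian := by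
    rw [Matrix.IsHermitian, Matrix.conjTranspose_smul, hA.eq, star_trivial]
  obtain ⟨φ, hφ⟩ := exists_nonneg_on_ker hA
  obtain ⟨ψ, hψ⟩ := exists_neg_on_range hA
  apply le_antisymm
  · simpa using negEigCount_le_finrank hcA φ fun x hx => by
      rw [Matrix.smul_mulVec, dotProduct_smul]
      exact mul_nonneg hc.le (hφ x hx)
  · simpa using finrank_le_negEigCount hcA ψ fun x hx => by
      rw [Matrix.smul_mulVec, dotProduct_smul]
      exact mul_neg_of_pos_of_neg hc (hψ x hx)

theorem negEigCount_submatrix_equiv {m n : Type*} [Fintype m] [DecidableEq m] [Fintype n]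
    [DecidableEq n] {A : Matrix n n ℝ} (hA : A.IsHermitian) (e : m ≃ n) :
    negEigCount (A.submatrix e e) = negEigCount A := by
  have key (x : m → ℝ) : x ⬝ᵥ A.submatrix e e *ᵥ x = (x ∘ e.symm) ⬝ᵥ A *ᵥ (x ∘ e.symm) := by
    rw [Matrix.submatrix_mulVec_equiv, comp_equiv_symm_dotProduct]
  have key' (x : n → ℝ) : (x ∘ e) ⬝ᵥ A.submatrix e e *ᵥ (x ∘ e) = x ⬝ᵥ A *ᵥ x := by
    rw [key, Function.comp_assoc, e.self_comp_symm, Function.comp_id]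
  obtain ⟨φ, hφ⟩ := exists_nonneg_on_ker hA
  obtain ⟨ψ, hψ⟩ := exists_neg_on_range hA
  apply le_antisymm
  · simpa using negEigCount_le_finrank (hA.submatrix e) (φ ∘ₗ LinearMap.funLeft ℝ ℝ e.symm)
      fun x hx => by
        rw [key]
        exact hφ _ hx
  · simpa using finrank_le_negEigCount (hA.submatrix e) (LinearMap.funLeft ℝ ℝ e ∘ₗ ψ)
      fun x hx => by
        have := hψ x hx
        rwa [← key'] at this

/-- Entrywise, `f` sends matrices with entries in `(-ρ, ρ)` and exactly `k` negative eigenvalues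
to matrices with exactly `k` negative eigenvalues. -/
def PreservesNegEigCount (ρ : EReal) (k : ℕ) (f : ℝ → ℝ) : Prop :=
  ∀ n : ℕ, k ≤ n → ∀ A : Matrix (Fin n) (Fin n) ℝ,
    A.IsSymm → (∀ i j, memI ρ (A i j)) → negEigCount A = k →
    ((A.map f).IsSymm ∧ negEigCount (A.map f) = k)

theorem Matrix.IsSymm.isHermitian_of_real {n : Type*} {A : Matrix n n ℝ} (hA : A.IsSymm) :
    A.IsHermitian := by
  rwa [Matrix.IsHermitian, Matrix.conjTranspose_eq_transpose_of_trivial]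

theorem PreservesNegEigCount.map {ρ : EReal} {k : ℕ} {f : ℝ → ℝ}
    (H : PreservesNegEigCount ρ k f) {n : Type*} [Fintype n] [DecidableEq n] {A : Matrix n n ℝ}
    (hA : A.IsSymm) (hmem : ∀ i j, memI ρ (A i j)) (hk : negEigCount A = k) :
    negEigCount (A.map f) = k := by
  let e := (Fintype.equivFin n).symm
  have h := H (Fintype.card n) (hk ▸ negEigCount_le_card hA.isHermitian_of_real)
    (A.submatrix e e) (hA.submatrix e) (fun i j => hmem _ _)
    (by rw [negEigCount_submatrix_equiv hA.isHermitian_of_real, hk])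
  rw [← negEigCount_submatrix_equiv (hA.map f).isHermitian_of_real e]
  exact h.2

/-- The `N × N` block matrix with diagonal blocks `V + U` and off-diagonal blocks `V`. -/
def diagPerturb (N : ℕ) {m : Type*} (V U : Matrix m m ℝ) : Matrix (Fin N × m) (Fin N × m) ℝ :=
  Matrix.of fun p q => V p.2 q.2 + if p.1 = q.1 then U p.2 q.2 else 0

theorem diagPerturb_isSymm (N : ℕ) {m : Type*} {V U : Matrix m m ℝ} (hV : V.IsSymm)
    (hU : U.IsSymm) : (diagPerturb N V U).IsSymm := by
  refine Matrix.IsSymm.ext fun p q => ?_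
  simp only [diagPerturb, Matrix.of_apply, hV.apply p.2 q.2, hU.apply p.2 q.2, eq_comm]

theorem diagPerturb_map (N : ℕ) {m : Type*} (V U : Matrix m m ℝ) (f : ℝ → ℝ) :
    (diagPerturb N V U).map f = diagPerturb N (V.map f) ((V + U).map f - V.map f) := by
  ext p q
  simp only [diagPerturb, Matrix.of_apply, Matrix.map_apply, Matrix.sub_apply, Matrix.add_apply]
  split_ifs <;> simp

theorem dotProduct_diagPerturb_mulVec (N : ℕ) {m : Type*} [Fintype m] (V U : Matrix m m ℝ)
    (x : Fin N × m → ℝ) :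
    x ⬝ᵥ diagPerturb N V U *ᵥ x =
      (fun i => ∑ s, x (s, i)) ⬝ᵥ V *ᵥ (fun i => ∑ s, x (s, i)) +
        ∑ s, (fun i => x (s, i)) ⬝ᵥ U *ᵥ (fun i => x (s, i)) := by
  have h1 (s : Fin N) (i : m) : (diagPerturb N V U *ᵥ x) (s, i) =
      (V *ᵥ fun i => ∑ s, x (s, i)) i + (U *ᵥ fun i => x (s, i)) i := by
    simp only [diagPerturb, mulVec, dotProduct, Matrix.of_apply, Fintype.sum_prod_type, add_mul,
      Finset.sum_add_distrib, Finset.mul_sum, ite_mul, zero_mul]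
    congr 1
    · exact Finset.sum_comm
    · rw [Finset.sum_comm]
      simp
  simp only [dotProduct, Fintype.sum_prod_type, h1, mul_add, Finset.sum_add_distrib,
    Finset.sum_mul]
  congr 1
  exact Finset.sum_comm

theorem PreservesNegEigCount.map_add_sub_map_nonneg {ρ : EReal} {k : ℕ} {f : ℝ → ℝ}
    (H : PreservesNegEigCount ρ k f) {m E F : Type*} [Fintype m] [DecidableEq m]
    [AddCommGroup E] [Module ℝ E] [FiniteDimensional ℝ E]
    [AddCommGroup F] [Module ℝ F] [FiniteDimensional ℝ F]
    {V U : Matrix m m ℝ} (hV : V.IsSymm) (hU : U.IsSymm)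
    (hVmem : ∀ i j, memI ρ (V i j)) (hVUmem : ∀ i j, memI ρ (V i j + U i j))
    (hU0 : ∀ x, 0 ≤ x ⬝ᵥ U *ᵥ x)
    (hE : finrank ℝ E = k) (ψ : E →ₗ[ℝ] (m → ℝ))
    (hψ : ∀ w, w ≠ 0 → ψ w ⬝ᵥ (V + U) *ᵥ ψ w < 0)
    (hF : finrank ℝ F = k) (φ : (m → ℝ) →ₗ[ℝ] F) (hφ : ∀ x, φ x = 0 → 0 ≤ x ⬝ᵥ V *ᵥ x)
    (x : m → ℝ) : 0 ≤ x ⬝ᵥ ((V + U).map f - V.map f) *ᵥ x := by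
  set N := k + 2 with hN
  have hB := diagPerturb_isSymm N hV hU
  have hcount : negEigCount (diagPerturb N V U) = k := by
    apply le_antisymm
    · let σ : (Fin N × m → ℝ) →ₗ[ℝ] (m → ℝ) := ∑ s, LinearMap.funLeft ℝ ℝ fun i => (s, i)
      have hσ (x) : σ x = fun i => ∑ s, x (s, i) := by
        ext i
        simp [σ, LinearMap.sum_apply, LinearMap.funLeft_apply]
      rw [← hF]
      refine negEigCount_le_finrank hB.isHermitian_of_real (φ ∘ₗ σ) fun x hx => ?_
      rw [dotProduct_diagPerturb_mulVec, ← hσ]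
      exact add_nonneg (hφ _ hx) (Finset.sum_nonneg fun s _ => hU0 _)
    · rw [← hE]
      refine finrank_le_negEigCount hB.isHermitian_of_real
        (LinearMap.funLeft ℝ ℝ Prod.snd ∘ₗ ψ) fun w hw => ?_
      have hw' := hψ w hw
      have hUw := hU0 (ψ w)
      rw [Matrix.add_mulVec, dotProduct_add] at hw'
      rw [dotProduct_diagPerturb_mulVec]
      have : (fun i => ∑ s : Fin N, (LinearMap.funLeft ℝ ℝ Prod.snd ∘ₗ ψ) w (s, i)) =
          (N : ℝ) • ψ w := by
        ext i
        simp [LinearMap.funLeft_apply]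
      rw [this, Matrix.mulVec_smul, dotProduct_smul, smul_dotProduct]
      simp only [LinearMap.comp_apply, LinearMap.funLeft_apply, Finset.sum_const,
        Finset.card_univ, Fintype.card_fin, nsmul_eq_mul, smul_eq_mul]
      have hN1 : (1 : ℝ) ≤ N := by exact_mod_cast (by omega : 1 ≤ N)
      set v := ψ w ⬝ᵥ V *ᵥ ψ w
      set u := ψ w ⬝ᵥ U *ᵥ ψ w
      change (N : ℝ) * (N * v) + N * u < 0
      have hNv : N * v + u < 0 := by nlinarith
      nlinarith
  have hmap := H.map hB (fun p q => by
    simp only [diagPerturb, Matrix.of_apply]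
    split_ifs
    · exact hVUmem _ _
    · simpa using hVmem _ _) hcount
  rw [diagPerturb_map] at hmap
  by_contra! hx
  set D := (V + U).map f - V.map f
  let ψ' : (Fin (k + 1) → ℝ) →ₗ[ℝ] (Fin N × m → ℝ) :=
    { toFun := fun a p => (Fin.cons (-∑ i, a i) a : Fin (k + 2) → ℝ) p.1 * x p.2
      map_add' := fun a b => by
        ext ⟨s, i⟩
        refine Fin.cases ?_ (fun s => ?_) s <;> simp [Finset.sum_add_distrib] <;> ring
      map_smul' := fun c a => by
        ext ⟨s, i⟩
        refine Fin.cases ?_ (fun s => ?_) s <;> simp [← Finset.mul_sum] <;> ring }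
  have hD : D.IsSymm := ((hV.add hU).map f).sub (hV.map f)
  have := finrank_le_negEigCount
    (diagPerturb_isSymm N (hV.map f) hD).isHermitian_of_real ψ' fun a ha => by
      rw [dotProduct_diagPerturb_mulVec]
      have h0 : (fun i => ∑ s, ψ' a (s, i)) = 0 := by
        ext i
        change ∑ s : Fin (k + 2), (Fin.cons (-∑ i, a i) a : Fin (k + 2) → ℝ) s * x i = 0
        rw [← Finset.sum_mul, Fin.sum_univ_succ]
        simp
      have h1 (s : Fin (k + 2)) : (fun i => ψ' a (s, i)) =
        (Fin.cons (-∑ i, a i) a : Fin (k + 2) → ℝ) s • x := rfl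
      rw [h0, zero_dotProduct, zero_add]
      obtain ⟨j, hj⟩ := Function.ne_iff.mp ha
      refine Finset.sum_neg' (fun s _ => ?_) ⟨Fin.succ j, Finset.mem_univ _, ?_⟩ <;>
        rw [h1, Matrix.mulVec_smul, dotProduct_smul, smul_dotProduct, smul_smul, smul_eq_mul]
      · exact mul_nonpos_of_nonneg_of_nonpos (mul_self_nonneg _) hx.le
      · refine mul_neg_of_pos_of_neg (mul_self_pos.mpr ?_) hx
        simpa using hj
  rw [finrank_fin_fun, hmap] at this
  omega

theorem memI_iff_abs_lt {ρ : EReal} {x : ℝ} : memI ρ x ↔ ((|x| : ℝ) : EReal) < ρ := by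
  rw [memI, EReal.neg_lt_comm, ← EReal.coe_neg]
  rcases abs_cases x with ⟨h, h0⟩ | ⟨h, h0⟩ <;> rw [h]
  · exact ⟨fun h => h.2, fun h => ⟨lt_of_le_of_lt (EReal.coe_le_coe_iff.mpr (by linarith)) h, h⟩⟩
  · exact ⟨fun h => h.1, fun h => ⟨h, lt_of_le_of_lt (EReal.coe_le_coe_iff.mpr (by linarith)) h⟩⟩

theorem memI.of_abs_le {ρ : EReal} {x y : ℝ} (hx : memI ρ x) (h : |y| ≤ |x|) : memI ρ y := by
  rw [memI_iff_abs_lt] at hx ⊢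
  exact (EReal.coe_le_coe_iff.mpr h).trans_lt hx

theorem memI.zero {ρ : EReal} (hρ : 0 < ρ) : memI ρ 0 := by
  rw [memI_iff_abs_lt]
  simpa using hρ

theorem memI.neg {ρ : EReal} {x : ℝ} (hx : memI ρ x) : memI ρ (-x) :=
  hx.of_abs_le (abs_neg x).le

theorem exists_pos_memI {ρ : EReal} (hρ : 0 < ρ) : ∃ δ : ℝ, 0 < δ ∧ memI ρ δ := by
  obtain ⟨δ, h0, hδ⟩ := EReal.lt_iff_exists_real_btwn.mp hρ
  have h0' : 0 < δ := by exact_mod_cast h0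
  exact ⟨δ, h0', by rwa [memI_iff_abs_lt, abs_of_pos h0']⟩

theorem dotProduct_fromBlocks_mulVec {m n : Type*} [Fintype m] [Fintype n] (A : Matrix m m ℝ)
    (D : Matrix n n ℝ) (z : m ⊕ n → ℝ) :
    z ⬝ᵥ fromBlocks A 0 0 D *ᵥ z =
      (z ∘ Sum.inl) ⬝ᵥ A *ᵥ (z ∘ Sum.inl) + (z ∘ Sum.inr) ⬝ᵥ D *ᵥ (z ∘ Sum.inr) := by
  rw [Matrix.fromBlocks_mulVec, Matrix.dotProduct_block]
  simp

theorem dotProduct_diagonal_const_mulVec {n : Type*} [Fintype n] [DecidableEq n] (c : ℝ)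
    (z : n → ℝ) : z ⬝ᵥ diagonal (fun _ => c) *ᵥ z = c * (z ⬝ᵥ z) := by
  simp only [dotProduct, mulVec_diagonal, Finset.mul_sum]
  exact Finset.sum_congr rfl fun i _ => by ring

theorem dotProduct_self_pos_of_ne_zero {n : Type*} [Fintype n] {x : n → ℝ} (hx : x ≠ 0) :
    0 < x ⬝ᵥ x :=
  lt_of_le_of_ne (dotProduct_self_star_nonneg x) (Ne.symm (by simpa using hx))

theorem PreservesNegEigCount.map_add_sub_map_nonneg_of_le {ρ : EReal} (hρ : 0 < ρ) {k : ℕ}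
    {f : ℝ → ℝ} (H : PreservesNegEigCount ρ k f) {m E F : Type*} [Fintype m] [DecidableEq m]
    [AddCommGroup E] [Module ℝ E] [FiniteDimensional ℝ E]
    [AddCommGroup F] [Module ℝ F] [FiniteDimensional ℝ F]
    {V U : Matrix m m ℝ} (hV : V.IsSymm) (hU : U.IsSymm)
    (hVmem : ∀ i j, memI ρ (V i j)) (hVUmem : ∀ i j, memI ρ (V i j + U i j))
    (hU0 : ∀ x, 0 ≤ x ⬝ᵥ U *ᵥ x) (hk : finrank ℝ E ≤ k)
    (ψ : E →ₗ[ℝ] (m → ℝ)) (hψ : ∀ w, w ≠ 0 → ψ w ⬝ᵥ (V + U) *ᵥ ψ w < 0)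
    (hF : finrank ℝ F = finrank ℝ E) (φ : (m → ℝ) →ₗ[ℝ] F)
    (hφ : ∀ x, φ x = 0 → 0 ≤ x ⬝ᵥ V *ᵥ x)
    (x : m → ℝ) : 0 ≤ x ⬝ᵥ ((V + U).map f - V.map f) *ᵥ x := by
  obtain ⟨δ, hδ, hδmem⟩ := exists_pos_memI hρ
  obtain ⟨r, rfl⟩ := Nat.exists_eq_add_of_le hk
  let e := LinearEquiv.sumArrowLequivProdArrow m (Fin r) ℝ ℝ
  have hadd : fromBlocks V 0 0 (diagonal fun _ : Fin r => -δ) + fromBlocks U 0 0 0 =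
      fromBlocks (V + U) 0 0 (diagonal fun _ : Fin r => -δ) := by
    simp [Matrix.fromBlocks_add]
  have hdiag (i j : Fin r) : memI ρ (diagonal (fun _ : Fin r => -δ) i j) := by
    rw [Matrix.diagonal_apply]
    split_ifs
    · exact hδmem.neg
    · exact memI.zero hρ
  have key := H.map_add_sub_map_nonneg (E := E × (Fin r → ℝ)) (F := F × (Fin r → ℝ))
    (V := fromBlocks V 0 0 (diagonal fun _ : Fin r => -δ)) (U := fromBlocks U 0 0 0)
    (hV.fromBlocks (by simp) (Matrix.isSymm_diagonal _)) (hU.fromBlocks (by simp) (by simp))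
    (by rintro (i | i) (j | j) <;> simp [hVmem, hdiag, memI.zero hρ])
    (by rintro (i | i) (j | j) <;> simp [hVUmem, hdiag, memI.zero hρ])
    (fun z => by simpa [dotProduct_fromBlocks_mulVec] using hU0 _)
    (by simp) (e.symm.toLinearMap ∘ₗ ψ.prodMap LinearMap.id)
    (fun ⟨w, a⟩ hw => by
      rw [hadd, dotProduct_fromBlocks_mulVec, dotProduct_diagonal_const_mulVec]
      change ψ w ⬝ᵥ (V + U) *ᵥ ψ w + -δ * (a ⬝ᵥ a) < 0
      have ha : 0 ≤ a ⬝ᵥ a := dotProduct_self_star_nonneg a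
      by_cases hw0 : w = 0
      · have ha0 : a ≠ 0 := fun ha0 => hw (by simp [hw0, ha0])
        have := dotProduct_self_pos_of_ne_zero ha0
        simp only [hw0, map_zero, zero_dotProduct]
        nlinarith
      · nlinarith [hψ w hw0])
    (by simp [hF]) (φ.prodMap LinearMap.id ∘ₗ e.toLinearMap)
    (fun z hz => by
      have h1 : φ (z ∘ Sum.inl) = 0 := congrArg Prod.fst hz
      have h2 : z ∘ Sum.inr = 0 := congrArg Prod.snd hz
      rw [dotProduct_fromBlocks_mulVec, h2]
      simpa using hφ _ h1)
    (Sum.elim x 0)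
  have hmap : (fromBlocks V 0 0 (diagonal fun _ : Fin r => -δ) + fromBlocks U 0 0 0).map f -
      (fromBlocks V 0 0 (diagonal fun _ : Fin r => -δ)).map f =
      fromBlocks ((V + U).map f - V.map f) 0 0 0 := by
    ext (i | i) (j | j) <;> simp
  rw [hmap, dotProduct_fromBlocks_mulVec] at key
  simpa using key

theorem sq_le_mul_of_forall_nonneg {p q r : ℝ}
    (h : ∀ v : Fin 2 → ℝ, 0 ≤ v ⬝ᵥ !![p, q; q, r] *ᵥ v) : 0 ≤ p ∧ q ^ 2 ≤ p * r := by
  simp only [dotProduct, mulVec, Fin.sum_univ_two] at h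
  refine ⟨by simpa using h ![1, 0], ?_⟩
  have := discrim_le_zero (a := p) (b := 2 * q) (c := r) fun t => by
    have := h ![t, 1]
    simp at this
    linarith
  rw [discrim] at this
  linarith

theorem PreservesNegEigCount.sq_sub_le {ρ : EReal} (hρ : 0 < ρ) {k : ℕ}
    {f : ℝ → ℝ} (H : PreservesNegEigCount ρ k f) {E F : Type*}
    [AddCommGroup E] [Module ℝ E] [FiniteDimensional ℝ E]
    [AddCommGroup F] [Module ℝ F] [FiniteDimensional ℝ F]
    {x y z u w : ℝ} (hu : 0 ≤ u) (hw : w ^ 2 = u ^ 2)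
    (hx : memI ρ x) (hy : memI ρ y) (hz : memI ρ z)
    (hxu : memI ρ (x + u)) (hyw : memI ρ (y + w)) (hzu : memI ρ (z + u)) (hk : finrank ℝ E ≤ k)
    (ψ : E →ₗ[ℝ] (Fin 2 → ℝ))
    (hψ : ∀ a, a ≠ 0 → ψ a ⬝ᵥ !![x + u, y + w; y + w, z + u] *ᵥ ψ a < 0)
    (hF : finrank ℝ F = finrank ℝ E) (φ : (Fin 2 → ℝ) →ₗ[ℝ] F)
    (hφ : ∀ v, φ v = 0 → 0 ≤ v ⬝ᵥ !![x, y; y, z] *ᵥ v) :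
    0 ≤ f (x + u) - f x ∧
      (f (y + w) - f y) ^ 2 ≤ (f (x + u) - f x) * (f (z + u) - f z) := by
  have hadd : !![x, y; y, z] + !![u, w; w, u] = !![x + u, y + w; y + w, z + u] := by simp
  refine sq_le_mul_of_forall_nonneg fun v => ?_
  have key := H.map_add_sub_map_nonneg_of_le hρ (V := !![x, y; y, z]) (U := !![u, w; w, u])
    (Matrix.IsSymm.ext fun i j => by fin_cases i <;> fin_cases j <;> rfl)
    (Matrix.IsSymm.ext fun i j => by fin_cases i <;> fin_cases j <;> rfl)
    (fun i j => by fin_cases i <;> fin_cases j <;> simpa)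
    (fun i j => by fin_cases i <;> fin_cases j <;> simpa)
    (fun v => by
      simp only [dotProduct, mulVec, Fin.sum_univ_two]
      simp
      rcases sq_eq_sq_iff_eq_or_eq_neg.mp hw with rfl | rfl
      · nlinarith [mul_nonneg hu (sq_nonneg (v 0 + v 1))]
      · nlinarith [mul_nonneg hu (sq_nonneg (v 0 - v 1))])
    hk ψ (by rwa [hadd]) hF φ hφ v
  have hmap : (!![x, y; y, z] + !![u, w; w, u]).map f - (!![x, y; y, z]).map f =
      !![f (x + u) - f x, f (y + w) - f y; f (y + w) - f y, f (z + u) - f z] := by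
    ext i j
    fin_cases i <;> fin_cases j <;> simp
  rwa [hmap] at key

theorem PreservesNegEigCount.add_sub_eq {ρ : EReal} (hρ : 0 < ρ) {k : ℕ} (hk : 1 ≤ k)
    {f : ℝ → ℝ} (H : PreservesNegEigCount ρ k f) {x u : ℝ} (hx : 0 ≤ x) (hu : 0 ≤ u)
    (hxu : memI ρ (x + u)) : 0 ≤ f u - f 0 ∧ f (x + u) - f x = f u - f 0 := by
  have hxm : memI ρ x := hxu.of_abs_le (by rw [abs_of_nonneg hx, abs_of_nonneg] <;> linarith)
  have hum : memI ρ u := hxu.of_abs_le (by rw [abs_of_nonneg hu, abs_of_nonneg] <;> linarith)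
  have h0 := memI.zero hρ
  have h1 := H.sq_sub_le hρ (E := Fin 0 → ℝ) (F := Fin 0 → ℝ) (x := x) (y := 0) (z := 0)
    (u := u) (w := u) hu rfl hxm h0 h0 hxu (by simpa) (by simpa) (by simp) 0
    (fun a ha => (ha (Subsingleton.elim _ _)).elim) rfl 0 (fun v _ => by
      simp [dotProduct, mulVec, Fin.sum_univ_two]
      nlinarith [mul_nonneg hx (sq_nonneg (v 0))])
  rcases hx.eq_or_lt with rfl | hx'
  · simpa using h1.1
  · have h2 := H.sq_sub_le hρ (E := ℝ) (F := ℝ) (x := 0) (y := x) (z := 0)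
      (u := u) (w := u) hu rfl h0 hxm h0 (by simpa) (by simpa) (by simpa) (by simpa)
      (LinearMap.toSpanSingleton ℝ _ ![1, -1])
      (fun a ha => by
        simp [dotProduct, mulVec, Fin.sum_univ_two]
        nlinarith [mul_pos hx' (sq_pos_iff.mpr ha)]) rfl (LinearMap.proj 0) (fun v hv => by
        simp at hv
        simp [dotProduct, mulVec, Fin.sum_univ_two, hv])
    simp only [zero_add] at h1 h2
    have h3 : f (x + u) - f x ≤ f u - f 0 :=
      (abs_le_of_sq_le_sq' (h2.2.trans_eq (sq _).symm) h2.1).2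
    refine ⟨h2.1, le_antisymm h3 ?_⟩
    rcases h2.1.eq_or_lt with h4 | h4
    · linarith [h1.1]
    · have := h1.2
      rw [sq] at this
      exact le_of_mul_le_mul_right this h4

theorem PreservesNegEigCount.sub_neg_eq {ρ : EReal} (hρ : 0 < ρ) {k : ℕ} (hk : 1 ≤ k)
    {f : ℝ → ℝ} (H : PreservesNegEigCount ρ k f) {x : ℝ} (hx : 0 < x) (hxm : memI ρ x) :
    f 0 - f (-x) = f x - f 0 := by
  have h0 := memI.zero hρ
  have h1 := H.sq_sub_le hρ (E := Fin 0 → ℝ) (F := Fin 0 → ℝ) (x := 0) (y := 0) (z := 0)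
    (u := x) (w := -x) hx.le (neg_sq x) h0 h0 h0 (by simpa) (by simpa using hxm.neg) (by simpa)
    (by simp) 0 (fun a ha => (ha (Subsingleton.elim _ _)).elim) rfl 0 (fun v _ => by
      simp [dotProduct, mulVec, Fin.sum_univ_two])
  have h2 := H.sq_sub_le hρ (E := ℝ) (F := ℝ) (x := -x) (y := 0) (z := 0)
    (u := x) (w := x) hx.le rfl hxm.neg h0 h0 (by simpa) (by simpa) (by simpa) (by simpa)
    (LinearMap.toSpanSingleton ℝ _ ![-1, 1])
    (fun a ha => by
      simp [dotProduct, mulVec, Fin.sum_univ_two]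
      nlinarith [mul_pos hx (sq_pos_iff.mpr ha)]) rfl (LinearMap.proj 0) (fun v hv => by
      simp at hv
      simp [dotProduct, mulVec, Fin.sum_univ_two, hv])
  simp only [zero_add, neg_add_cancel] at h1 h2
  have h3 := (abs_le_of_sq_le_sq' (h1.2.trans_eq (sq _).symm) h1.1).1
  refine le_antisymm (by linarith) ?_
  rcases h1.1.eq_or_lt with h4 | h4
  · linarith [h2.1]
  · have := h2.2
    rw [sq] at this
    exact le_of_mul_le_mul_right this h4

theorem PreservesNegEigCount.natCast_mul {ρ : EReal} (hρ : 0 < ρ) {k : ℕ} (hk : 1 ≤ k)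
    {f : ℝ → ℝ} (H : PreservesNegEigCount ρ k f) {t : ℝ} (ht : 0 ≤ t) (m : ℕ)
    (hm : memI ρ (m * t)) : f (m * t) - f 0 = m * (f t - f 0) := by
  induction m with
  | zero => simp
  | succ m ih =>
    have hmt : 0 ≤ (m : ℝ) * t := by positivity
    push_cast at hm ⊢
    rw [add_mul, one_mul] at hm ⊢
    have h1 := (H.add_sub_eq hρ hk hmt ht hm).2
    have h2 := ih (hm.of_abs_le (by rw [abs_of_nonneg hmt, abs_of_nonneg] <;> linarith))
    linarith

theorem PreservesNegEigCount.mul_le_mul {ρ : EReal} (hρ : 0 < ρ) {k : ℕ} (hk : 1 ≤ k)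
    {f : ℝ → ℝ} (H : PreservesNegEigCount ρ k f) {x y : ℝ} (hx : 0 < x) (hy : 0 < y)
    (hxm : memI ρ x) (hym : memI ρ y) : y * (f x - f 0) ≤ x * (f y - f 0) := by
  have hfx : 0 ≤ f x - f 0 := (H.add_sub_eq hρ hk le_rfl hx.le (by simpa)).1
  by_contra! hlt
  obtain ⟨n, hn⟩ := exists_nat_gt (x * (f x - f 0) / (y * (f x - f 0) - x * (f y - f 0)))
  rw [div_lt_iff₀ (by linarith)] at hn
  have hn0 : 0 < n := by
    rcases Nat.eq_zero_or_pos n with rfl | h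
    · rw [Nat.cast_zero, zero_mul] at hn
      nlinarith
    · exact h
  have hn0' : (0 : ℝ) < n := by exact_mod_cast hn0
  set t := x / n with ht
  have ht0 : 0 < t := by positivity
  have hnt : n * t = x := by rw [ht]; field_simp
  have h1 := H.natCast_mul hρ hk ht0.le n (by rwa [hnt])
  rw [hnt] at h1
  set m := ⌊y / t⌋₊
  have hm1 : m * t ≤ y := (le_div_iff₀ ht0).mp (Nat.floor_le (by positivity))
  have hm2 : y < (m + 1) * t := (div_lt_iff₀ ht0).mp (Nat.lt_floor_add_one _)
  have hmt : 0 ≤ (m : ℝ) * t := by positivity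
  have h2 := H.natCast_mul hρ hk ht0.le m
    (hym.of_abs_le (by rwa [abs_of_nonneg hmt, abs_of_nonneg hy.le]))
  have h3 := H.add_sub_eq hρ hk hmt (sub_nonneg.mpr hm1) (by simpa)
  rw [add_sub_cancel] at h3
  have h4 : m * (f t - f 0) ≤ f y - f 0 := by linarith
  have h5 : 0 ≤ f t - f 0 := (H.add_sub_eq hρ hk le_rfl ht0.le
    (by rw [zero_add]; exact hxm.of_abs_le (by
      rw [abs_of_pos ht0, abs_of_pos hx]; exact div_le_self hx.le (by exact_mod_cast hn0)))).1
  have h6 : n * (y * (f x - f 0)) ≤ n * (x * (f y - f 0)) + x * (f x - f 0) := by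
    have e1 : y * (f t - f 0) ≤ (m + 1) * t * (f t - f 0) :=
      mul_le_mul_of_nonneg_right hm2.le h5
    have e2 : t * (m * (f t - f 0)) ≤ t * (f y - f 0) := mul_le_mul_of_nonneg_left h4 ht0.le
    have e3 : y * (f t - f 0) ≤ t * (f y - f 0) + t * (f t - f 0) := by linarith
    have e4 := mul_le_mul_of_nonneg_left e3 (mul_pos hn0' hn0').le
    rw [h1, ← hnt]
    linarith
  linarith

theorem PreservesNegEigCount.exists_affine {ρ : EReal} (hρ : 0 < ρ) {k : ℕ} (hk : 1 ≤ k)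
    {f : ℝ → ℝ} (H : PreservesNegEigCount ρ k f) :
    ∃ c : ℝ, 0 ≤ c ∧ ∀ x, memI ρ x → f x = f 0 + c * x := by
  obtain ⟨δ, hδ, hδm⟩ := exists_pos_memI hρ
  have hfδ : 0 ≤ f δ - f 0 := (H.add_sub_eq hρ hk le_rfl hδ.le (by simpa)).1
  have hpos (x : ℝ) (hx : 0 < x) (hxm : memI ρ x) : f x - f 0 = (f δ - f 0) / δ * x := by
    have := (H.mul_le_mul hρ hk hx hδ hxm hδm).antisymm (H.mul_le_mul hρ hk hδ hx hδm hxm)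
    field_simp
    linarith
  refine ⟨(f δ - f 0) / δ, div_nonneg hfδ hδ.le, fun x hxm => ?_⟩
  rcases lt_trichotomy x 0 with hx | rfl | hx
  · have h1 := H.sub_neg_eq hρ hk (neg_pos.mpr hx) hxm.neg
    rw [neg_neg, hpos _ (neg_pos.mpr hx) hxm.neg] at h1
    linarith
  · simp
  · linarith [hpos x hx hxm]

theorem dotProduct_const_mulVec {n : Type*} [Fintype n] (b : ℝ) (x : n → ℝ) :
    x ⬝ᵥ (Matrix.of fun _ _ : n => b) *ᵥ x = b * (∑ i, x i) ^ 2 := by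
  simp only [dotProduct, mulVec, Matrix.of_apply, ← Finset.mul_sum, ← Finset.sum_mul]
  ring

theorem negEigCount_const {n : Type*} [Fintype n] [DecidableEq n] [Nonempty n] {b : ℝ}
    (hb : b < 0) : negEigCount (Matrix.of fun _ _ : n => b) = 1 := by
  have hA : (Matrix.of fun _ _ : n => b).IsHermitian :=
    (Matrix.IsSymm.ext fun _ _ => rfl).isHermitian_of_real
  obtain ⟨i⟩ := ‹Nonempty n›
  apply le_antisymm
  · simpa using negEigCount_le_finrank hA (∑ i, LinearMap.proj (R := ℝ) (φ := fun _ => ℝ) i)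
      fun x hx => by
        rw [dotProduct_const_mulVec]
        simp only [LinearMap.sum_apply, LinearMap.proj_apply] at hx
        simp [hx]
  · simpa using finrank_le_negEigCount hA (LinearMap.toSpanSingleton ℝ _ (Pi.single i 1))
      fun a ha => by
        rw [dotProduct_const_mulVec]
        simpa [← Finset.mul_sum] using mul_neg_of_neg_of_pos hb (sq_pos_iff.mpr ha)

theorem negEigCount_diagonal_const {n : Type*} [Fintype n] [DecidableEq n] {c : ℝ}
    (hc : c < 0) : negEigCount (diagonal fun _ : n => c) = Fintype.card n := by
  rw [negEigCount_eq_card_iff (Matrix.isSymm_diagonal _).isHermitian_of_real]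
  intro x hx
  rw [dotProduct_diagonal_const_mulVec]
  exact mul_neg_of_neg_of_pos hc (dotProduct_self_pos_of_ne_zero hx)

theorem PreservesNegEigCount.linear_or_const {ρ : EReal} (hρ : 0 < ρ) {k : ℕ} (hk : 1 ≤ k)
    {f : ℝ → ℝ} (H : PreservesNegEigCount ρ k f) :
    (∃ c : ℝ, 0 < c ∧ ∀ x : ℝ, memI ρ x → f x = c * x) ∨
     (k = 1 ∧ ∃ c : ℝ, 0 < c ∧ ∀ x : ℝ, memI ρ x → f x = -c) := by
  obtain ⟨c, hc, hf⟩ := H.exists_affine hρ hk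
  obtain ⟨δ₀, hδ₀, hδ₀m⟩ := exists_pos_memI hρ
  have h0 := memI.zero hρ
  set b := f 0
  have hsymm (δ : ℝ) : (diagonal fun _ : Fin k => -δ).IsSymm := Matrix.isSymm_diagonal _
  have hneg (δ : ℝ) (hδ : 0 < δ) (hδm : memI ρ δ) (x : Fin k → ℝ) (hx : x ≠ 0) :
      x ⬝ᵥ (diagonal fun _ : Fin k => -δ).map f *ᵥ x < 0 := by
    refine (negEigCount_eq_card_iff ((hsymm δ).map f).isHermitian_of_real).mp ?_ x hx
    rw [Fintype.card_fin]
    refine H.map (hsymm δ) (fun i j => ?_) ?_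
    · rw [Matrix.diagonal_apply]
      split_ifs
      · exact hδm.neg
      · exact h0
    · rw [negEigCount_diagonal_const (by linarith), Fintype.card_fin]
  have hfneg (δ : ℝ) (hδ : 0 < δ) (hδm : memI ρ δ) : b - c * δ < 0 := by
    have := hneg δ hδ hδm (Pi.single ⟨0, hk⟩ 1) (by simp)
    simp only [Matrix.mulVec_single_one, single_one_dotProduct, Matrix.col_apply,
      Matrix.map_apply, Matrix.diagonal_apply_eq] at this
    rw [hf _ hδm.neg] at this
    linarith
  have hb : b ≤ 0 := by
    by_contra! hb
    have hmin : 0 < min δ₀ (b / (c + 1)) := lt_min hδ₀ (by positivity)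
    have := hfneg _ hmin (hδ₀m.of_abs_le (by
      rw [abs_of_pos hmin, abs_of_pos hδ₀]; exact min_le_left _ _))
    have h2 : min δ₀ (b / (c + 1)) * (c + 1) ≤ b :=
      (le_div_iff₀ (by positivity)).mp (min_le_right _ _)
    nlinarith
  rcases hb.eq_or_lt with hb | hb
  · left
    refine ⟨c, ?_, fun x hx => by rw [hf x hx, hb, zero_add]⟩
    have := hfneg δ₀ hδ₀ hδ₀m
    rw [hb] at this
    exact pos_of_mul_pos_left (by linarith : 0 < c * δ₀) hδ₀.le
  rcases hc.eq_or_lt with rfl | hc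
  · right
    refine ⟨?_, -b, by linarith, fun x hx => by rw [hf x hx]; ring⟩
    have hconst : (diagonal fun _ : Fin k => -δ₀).map f = Matrix.of fun _ _ => b := by
      ext i j
      rw [Matrix.map_apply, Matrix.of_apply, hf, zero_mul, add_zero]
      rw [Matrix.diagonal_apply]
      split_ifs
      · exact hδ₀m.neg
      · exact h0
    have : Nonempty (Fin k) := ⟨⟨0, hk⟩⟩
    have h1 := negEigCount_const (n := Fin k) hb
    rw [← hconst, (negEigCount_eq_card_iff ((hsymm δ₀).map f).isHermitian_of_real).mpr
      (hneg δ₀ hδ₀ hδ₀m), Fintype.card_fin] at h1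
    exact h1
  · exfalso
    let A : Matrix (Fin k ⊕ Unit) (Fin k ⊕ Unit) ℝ :=
      fromBlocks (diagonal fun _ => -δ₀) 0 0 0
    have hA : A.IsSymm := (hsymm δ₀).fromBlocks (by simp) (by simp)
    have hmem : ∀ i j, memI ρ (A i j) := by
      rintro (i | i) (j | j)
      · change memI ρ (diagonal (fun _ => -δ₀) i j)
        rw [Matrix.diagonal_apply]
        split_ifs
        · exact hδ₀m.neg
        · exact h0
      all_goals exact h0
    have hform (x : Fin k ⊕ Unit → ℝ) :
        x ⬝ᵥ A *ᵥ x = -δ₀ * ((x ∘ Sum.inl) ⬝ᵥ (x ∘ Sum.inl)) := by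
      rw [dotProduct_fromBlocks_mulVec, dotProduct_diagonal_const_mulVec]
      simp
    have hcount : negEigCount A = k := by
      apply le_antisymm
      · simpa using negEigCount_le_finrank hA.isHermitian_of_real
          (LinearMap.funLeft ℝ ℝ Sum.inl : _ →ₗ[ℝ] (Fin k → ℝ)) fun x hx => by
            rw [hform, show x ∘ Sum.inl = 0 from hx]
            simp
      · simpa using finrank_le_negEigCount hA.isHermitian_of_real
          ((LinearEquiv.sumArrowLequivProdArrow (Fin k) Unit ℝ ℝ).symm.toLinearMap ∘ₗ
            LinearMap.inl ℝ (Fin k → ℝ) (Unit → ℝ)) fun x hx => by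
            rw [hform]
            change -δ₀ * (x ⬝ᵥ x) < 0
            exact mul_neg_of_neg_of_pos (by linarith) (dotProduct_self_pos_of_ne_zero hx)
    have hmap : A.map f = (Matrix.of fun _ _ => b) + c • A := by
      ext i j
      simp [hf _ (hmem i j)]
    have := H.map hA hmem hcount
    have h1 := (negEigCount_eq_card_iff (hA.map f).isHermitian_of_real).mpr fun x hx => by
      rw [hmap, Matrix.add_mulVec, dotProduct_add, dotProduct_const_mulVec, Matrix.smul_mulVec,
        dotProduct_smul, hform, smul_eq_mul]
      have hcδ : 0 < c * δ₀ := mul_pos hc hδ₀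
      by_cases hl : x ∘ Sum.inl = 0
      · have hs : ∑ i, x i = x (Sum.inr ()) := by
          have (i : Fin k) : x (Sum.inl i) = 0 := congrFun hl i
          simp [Fintype.sum_sum_type, this]
        have hr : x (Sum.inr ()) ≠ 0 := fun hr => hx (by
          ext (i | i)
          · exact congrFun hl i
          · exact hr)
        rw [hs, hl]
        simpa using mul_neg_of_neg_of_pos hb (sq_pos_iff.mpr hr)
      · have hl' : 0 < (x ∘ Sum.inl) ⬝ᵥ (x ∘ Sum.inl) := dotProduct_self_pos_of_ne_zero hl
        nlinarith [mul_pos hcδ hl', mul_nonneg (neg_nonneg.mpr hb.le) (sq_nonneg (∑ i, x i))]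
    rw [this] at h1
    simp at h1

/-- Theorem 1.3: `f[-]` sends `S^(k)((-ρ,ρ))` to `S^(k)` (for positive `k`) if and only if
`f` is a positive homothety, or `k = 1` and `f` is a negative constant. -/
theorem negativity_preserver_iff (ρ : EReal) (hρ : 0 < ρ) (k : ℕ) (hk : 1 ≤ k) (f : ℝ → ℝ) :
    (∀ n : ℕ, k ≤ n → ∀ A : Matrix (Fin n) (Fin n) ℝ,
        A.IsSymm → (∀ i j, memI ρ (A i j)) → negEigCount A = k →
        ((A.map f).IsSymm ∧ negEigCount (A.map f) = k)) ↔
    ((∃ c : ℝ, 0 < c ∧ ∀ x : ℝ, memI ρ x → f x = c * x) ∨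
     (k = 1 ∧ ∃ c : ℝ, 0 < c ∧ ∀ x : ℝ, memI ρ x → f x = -c)) := by
  constructor
  · exact fun H => PreservesNegEigCount.linear_or_const hρ hk H
  · rintro (⟨c, hc, hf⟩ | ⟨rfl, c, hc, hf⟩) n hn A hA hmem hcount
    · have hmap : A.map f = c • A := by
        ext i j
        simp [hf _ (hmem i j)]
      exact ⟨hA.map f, by rw [hmap, negEigCount_smul hA.isHermitian_of_real hc, hcount]⟩
    · have hmap : A.map f = Matrix.of fun _ _ => -c := by
        ext i j
        simp [hf _ (hmem i j)]
      have : Nonempty (Fin n) := ⟨⟨0, hn⟩⟩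
      exact ⟨hA.map f, by rw [hmap, negEigCount_const (neg_neg_of_pos hc)]⟩
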